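/- Assume q_0 is supported in the Euclidean ball {y ∈ ℝ^d : ‖y‖₂ ≤ √d}. Then for every t > 0 and every x ∈ ℝ^d, ∂_t ∇_x log q_t(x) = − (λ_t(2 − σ_t²)/σ_t⁴) m(t, x) + (2 λ_t²/σ_t⁴) x − (λ_t²(2 − σ_t²)/σ_t⁶) C_t(x) x + (λ_t³/σ_t⁶) v_t(x), where v_t(x) = E_{t,x}[ ‖θ‖₂² (θ − m(t, x)) ]. -/

import Mathlib

open MeasureTheory ProbabilityTheory Real
open scoped RealInnerProductSpace

noncomputable section

abbrev Vec (d : ℕ) := EuclideanSpace ℝ (Fin d)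

def stdGaussian (d : ℕ) : Measure (Vec d) :=
  Measure.map (⇑(EuclideanSpace.equiv (Fin d) ℝ).symm)
    (Measure.pi fun _ : Fin d => gaussianReal 0 1)

/-- The law `q_u` of `e^{-u} θ + √(1 - e^{-2u}) g`, with `θ ~ q0` and `g ~ N(0, I_d)`
independent. -/
def forwardLaw {d : ℕ} (q0 : Measure (Vec d)) (u : ℝ) : Measure (Vec d) :=
  Measure.map (fun p : Vec d × Vec d =>
      Real.exp (-u) • p.1 + Real.sqrt (1 - Real.exp (-2*u)) • p.2)
    (q0.prod (stdGaussian d))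

/-- Gaussian weight `exp(-‖x - λ_t θ‖² / (2σ_t²))`. -/
def weight {d : ℕ} (t : ℝ) (x θ : Vec d) : ℝ :=
  Real.exp (-‖x - Real.exp (-t) • θ‖^2 / (2 * (1 - Real.exp (-2*t))))

/-- The conditional law `μ_{t,x}` of `θ` given `λ_t θ + σ_t g = x`:
`dμ_{t,x}(θ) = Z_{t,x}⁻¹ exp(-‖x - λ_t θ‖²/(2σ_t²)) dq0(θ)`. -/
def condMeasure {d : ℕ} (q0 : Measure (Vec d)) (t : ℝ) (x : Vec d) : Measure (Vec d) :=
  (∫⁻ θ, ENNReal.ofReal (weight t x θ) ∂q0)⁻¹ •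
    q0.withDensity fun θ => ENNReal.ofReal (weight t x θ)

/-- The conditional mean `m(t, x) = E_{t,x}[θ]`. -/
def condMean {d : ℕ} (q0 : Measure (Vec d)) (t : ℝ) (x : Vec d) : Vec d :=
  ∫ θ, θ ∂(condMeasure q0 t x)

/-- Partial derivative in the `i`-th coordinate direction. -/
def pd {d : ℕ} (i : Fin d) (f : Vec d → ℝ) (x : Vec d) : ℝ :=
  fderiv ℝ f x (EuclideanSpace.single i 1)

lemma pi_gaussianReal_eq_withDensity (d : ℕ) :
    Measure.pi (fun _ : Fin d => gaussianReal 0 1) =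
      volume.withDensity fun g : Fin d → ℝ =>
        ENNReal.ofReal (∏ i, gaussianPDFReal 0 1 (g i)) := by
  refine Measure.pi_eq fun s hs => ?_
  have hint : Integrable (fun g : Fin d → ℝ => ∏ i, gaussianPDFReal 0 1 (g i)) :=
    Integrable.fintype_prod fun _ => integrable_gaussianPDFReal 0 1
  rw [withDensity_apply _ (MeasurableSet.univ_pi hs),
    ← ofReal_integral_eq_lintegral_ofReal hint.integrableOn
      (ae_of_all _ fun g => Finset.prod_nonneg fun i _ => gaussianPDFReal_nonneg 0 1 (g i)),
    volume_pi, Measure.restrict_pi_pi, integral_fintype_prod_eq_prod,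
    ENNReal.ofReal_prod_of_nonneg]
  · exact Finset.prod_congr rfl fun i _ =>
      (gaussianReal_apply_eq_integral 0 one_ne_zero (s i)).symm
  · exact fun i _ => integral_nonneg fun y => gaussianPDFReal_nonneg 0 1 y

lemma prod_gaussianPDFReal {d : ℕ} (g : Vec d) :
    ∏ i, gaussianPDFReal 0 1 (g i) = (√(2 * π))⁻¹ ^ d * rexp (-‖g‖ ^ 2 / 2) := by
  simp [gaussianPDFReal, Finset.prod_mul_distrib, ← Real.exp_sum, EuclideanSpace.real_norm_sq_eq,
    ← Finset.sum_div]

lemma stdGaussian_eq_withDensity (d : ℕ) :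
    _root_.stdGaussian d = volume.withDensity fun g : Vec d =>
      ENNReal.ofReal ((√(2 * π))⁻¹ ^ d * rexp (-‖g‖ ^ 2 / 2)) := by
  have hmp := PiLp.volume_preserving_toLp (Fin d)
  ext s hs
  rw [_root_.stdGaussian, pi_gaussianReal_eq_withDensity]
  change (Measure.map (WithLp.toLp 2) _) s = _
  rw [Measure.map_apply hmp.measurable hs, withDensity_apply _ (hmp.measurable hs),
    withDensity_apply _ hs, ← hmp.setLIntegral_comp_preimage hs (by fun_prop)]
  simp only [← prod_gaussianPDFReal]

lemma lintegral_comp_add_smul {d : ℕ} {f : Vec d → ENNReal} (hf : Measurable f) (a : Vec d)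
    {r : ℝ} (hr : r ≠ 0) :
    ∫⁻ g, f (a + r • g) = ENNReal.ofReal |(r ^ d)⁻¹| * ∫⁻ y, f y := by
  have hmeas : Measurable fun y => f (a + y) := by fun_prop
  rw [← lintegral_map (g := fun g : Vec d => r • g) hmeas (by fun_prop),
    Measure.map_addHaar_smul _ hr, lintegral_smul_measure, lintegral_add_left_eq_self]
  simp

/-- The normalising constant of the density of `forwardLaw q0 u` with respect to `weight u`. -/
def gaussianConst (d : ℕ) (u : ℝ) : ℝ :=
  |(√(1 - rexp (-2 * u)) ^ d)⁻¹| * (√(2 * π))⁻¹ ^ d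

lemma one_sub_exp_pos {u : ℝ} (hu : 0 < u) : 0 < 1 - rexp (-2 * u) := by
  have : rexp (-2 * u) < 1 := by simpa using hu
  linarith

lemma gaussianConst_pos (d : ℕ) {u : ℝ} (hu : 0 < u) : 0 < gaussianConst d u := by
  have := Real.sqrt_pos.2 (one_sub_exp_pos hu)
  unfold gaussianConst
  positivity

lemma continuous_weight_right {d : ℕ} (u : ℝ) (x : Vec d) : Continuous (weight u x) := by
  unfold weight
  fun_prop

lemma weight_pos {d : ℕ} (u : ℝ) (x θ : Vec d) : 0 < weight u x θ := Real.exp_pos _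

lemma weight_le_one {d : ℕ} {u : ℝ} (hu : 0 < u) (x θ : Vec d) : weight u x θ ≤ 1 := by
  have := one_sub_exp_pos hu
  refine Real.exp_le_one_iff.2 (div_nonpos_of_nonpos_of_nonneg ?_ (by positivity))
  simp

lemma integrable_weight {d : ℕ} {q0 : Measure (Vec d)} [IsFiniteMeasure q0] {u : ℝ} (hu : 0 < u)
    (x : Vec d) : Integrable (weight u x) q0 := by
  refine Integrable.of_bound (C := 1)
    (continuous_weight_right u x).aestronglyMeasurable
    (ae_of_all _ fun θ => ?_)
  rw [Real.norm_of_nonneg (weight_pos u x θ).le]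
  exact weight_le_one hu x θ

lemma lintegral_stdGaussian_comp_add_smul {d : ℕ} {u : ℝ} (hu : 0 < u) (θ : Vec d)
    {f : Vec d → ENNReal} (hf : Measurable f) :
    ∫⁻ g, f (rexp (-u) • θ + √(1 - rexp (-2 * u)) • g) ∂(_root_.stdGaussian d) =
      ∫⁻ y, f y * ENNReal.ofReal (gaussianConst d u * weight u y θ) := by
  have hS := one_sub_exp_pos hu
  have hσ := Real.sqrt_pos.2 hS
  have hw : Measurable fun y : Vec d => weight u y θ := by
    unfold weight
    fun_prop
  rw [stdGaussian_eq_withDensity,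
    lintegral_withDensity_eq_lintegral_mul _ (by fun_prop) (by fun_prop)]
  have hcomp := lintegral_comp_add_smul (f := fun y => f y *
    ENNReal.ofReal ((√(2 * π))⁻¹ ^ d * weight u y θ)) (by fun_prop) (rexp (-u) • θ) hσ.ne'
  rw [← lintegral_const_mul _ (by fun_prop)] at hcomp
  refine (lintegral_congr fun g => ?_).trans (hcomp.trans (lintegral_congr fun y => ?_))
  · rw [Pi.mul_apply, mul_comm]
    congr 3
    simp only [weight, add_sub_cancel_left, norm_smul, mul_pow, Real.norm_eq_abs, sq_abs]
    rw [Real.sq_sqrt hS.le]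
    congr 1
    generalize 1 - rexp (-2 * u) = S at hS
    field_simp
  · rw [gaussianConst, mul_assoc, ENNReal.ofReal_mul (abs_nonneg _)]
    ring

lemma forwardLaw_eq_withDensity {d : ℕ} (q0 : Measure (Vec d)) [IsProbabilityMeasure q0]
    {u : ℝ} (hu : 0 < u) :
    forwardLaw q0 u = volume.withDensity fun x =>
      ENNReal.ofReal (gaussianConst d u * ∫ θ, weight u x θ ∂q0) := by
  have : SFinite (_root_.stdGaussian d) := by
    rw [stdGaussian_eq_withDensity]; infer_instance
  ext s hs
  have hind : Measurable (s.indicator (1 : Vec d → ENNReal)) := measurable_one.indicator hs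
  have hind' : Measurable fun p : Vec d × Vec d => s.indicator (1 : Vec d → ENNReal)
      (rexp (-u) • p.1 + √(1 - rexp (-2 * u)) • p.2) := by fun_prop
  rw [forwardLaw, ← lintegral_indicator_one hs, lintegral_map hind (by fun_prop),
    lintegral_prod _ hind'.aemeasurable]
  simp only [lintegral_stdGaussian_comp_add_smul hu _ hind]
  have hprod : Measurable (Function.uncurry fun θ y : Vec d =>
      s.indicator (1 : Vec d → ENNReal) y *
        ENNReal.ofReal (gaussianConst d u * weight u y θ)) := by
    unfold Function.uncurry weight
    fun_prop
  rw [lintegral_lintegral_swap hprod.aemeasurable,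
    withDensity_apply _ hs, ← lintegral_indicator hs]
  refine lintegral_congr fun y => ?_
  have hwy : Measurable fun θ : Vec d => ENNReal.ofReal (gaussianConst d u * weight u y θ) := by
    unfold weight
    fun_prop
  rw [lintegral_const_mul _ hwy]
  by_cases hy : y ∈ s
  · rw [Set.indicator_of_mem hy, Set.indicator_of_mem hy, Pi.one_apply, one_mul,
      ← integral_const_mul,
      ofReal_integral_eq_lintegral_ofReal ((integrable_weight hu y).const_mul _)]
    exact ae_of_all _ fun θ => mul_nonneg (gaussianConst_pos d hu).le (weight_pos u y θ).le
  · simp [hy]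

lemma continuous_integral_weight {d : ℕ} (q0 : Measure (Vec d)) [IsFiniteMeasure q0] {u : ℝ}
    (hu : 0 < u) : Continuous fun x => ∫ θ, weight u x θ ∂q0 := by
  refine continuous_of_dominated (bound := fun _ => 1)
    (fun x => (integrable_weight hu x).aestronglyMeasurable)
    (fun x => ae_of_all _ fun θ => ?_) (integrable_const _)
    (ae_of_all _ fun θ => ?_)
  · rw [Real.norm_of_nonneg (weight_pos u x θ).le]
    exact weight_le_one hu x θ
  · unfold weight
    fun_prop

/-- A continuous nonnegative density of `forwardLaw q0 u` is the Gaussian mixture density. -/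
lemma density_eq {d : ℕ} (q0 : Measure (Vec d)) [IsProbabilityMeasure q0] {u : ℝ} (hu : 0 < u)
    {f : Vec d → ℝ} (hf : forwardLaw q0 u = volume.withDensity fun x => ENNReal.ofReal (f x))
    (hf_cont : Continuous f) (hf_nonneg : ∀ x, 0 ≤ f x) (x : Vec d) :
    f x = gaussianConst d u * ∫ θ, weight u x θ ∂q0 := by
  have hcont : Continuous fun x => gaussianConst d u * ∫ θ, weight u x θ ∂q0 :=
    (continuous_integral_weight q0 hu).const_mul _
  have hcont' : Continuous fun x => ENNReal.ofReal (gaussianConst d u * ∫ θ, weight u x θ ∂q0) :=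
    ENNReal.continuous_ofReal.comp hcont
  have hf_cont' : Continuous fun x => ENNReal.ofReal (f x) :=
    ENNReal.continuous_ofReal.comp hf_cont
  rw [forwardLaw_eq_withDensity q0 hu, withDensity_eq_iff_of_sigmaFinite
    hcont'.aemeasurable hf_cont'.aemeasurable, hcont'.ae_eq_iff_eq _ hf_cont'] at hf
  have hx := congrFun hf x
  rw [ENNReal.ofReal_eq_ofReal_iff _ (hf_nonneg x)] at hx
  · exact hx.symm
  · exact mul_nonneg (gaussianConst_pos d hu).le (integral_nonneg fun θ => (weight_pos u x θ).le)

lemma integrable_of_continuous_of_ae_norm_le {d : ℕ} {μ : Measure (Vec d)} [IsFiniteMeasure μ]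
    {R : ℝ} (hR : ∀ᵐ y ∂μ, ‖y‖ ≤ R) {f : Vec d → ℝ} (hf : Continuous f) : Integrable f μ := by
  obtain ⟨C, hC⟩ := (isCompact_closedBall (0 : Vec d) R).exists_bound_of_continuousOn
    hf.continuousOn
  refine Integrable.of_bound hf.aestronglyMeasurable C ?_
  filter_upwards [hR] with y hy
  exact hC y (by simpa using hy)

/-- Differentiation under the integral sign for a measure with bounded support. -/
lemma hasDerivAt_integral_of_ae_norm_le {d : ℕ} {μ : Measure (Vec d)} [IsFiniteMeasure μ]
    {R : ℝ} (hR : ∀ᵐ y ∂μ, ‖y‖ ≤ R) {F F' : ℝ → Vec d → ℝ} {r₀ : ℝ} {s : Set ℝ}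
    (hs : s ∈ nhds r₀) (hs_compact : IsCompact s) (hF : ∀ r ∈ s, Continuous (F r))
    (hF' : ContinuousOn (Function.uncurry F') (s ×ˢ Set.univ))
    (hderiv : ∀ r ∈ s, ∀ θ, HasDerivAt (F · θ) (F' r θ) r) :
    HasDerivAt (fun r => ∫ θ, F r θ ∂μ) (∫ θ, F' r₀ θ ∂μ) r₀ := by
  obtain ⟨C, hC⟩ := (hs_compact.prod (isCompact_closedBall (0 : Vec d) R)
    ).exists_bound_of_continuousOn (hF'.mono (Set.prod_mono_right (Set.subset_univ _)))
  have hr₀ : r₀ ∈ s := mem_of_mem_nhds hs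
  have hF'_cont : Continuous (F' r₀) :=
    hF'.comp_continuous (Continuous.prodMk_right r₀) fun θ => ⟨hr₀, Set.mem_univ θ⟩
  refine (hasDerivAt_integral_of_dominated_loc_of_deriv_le (bound := fun _ => C) hs ?_
    (integrable_of_continuous_of_ae_norm_le hR (hF r₀ hr₀)) hF'_cont.aestronglyMeasurable ?_
    (integrable_const C) (ae_of_all _ fun θ r hr => hderiv r hr θ)).2
  · filter_upwards [hs] with r hr using (hF r hr).aestronglyMeasurable
  · filter_upwards [hR] with θ hθ r hr
    exact hC (r, θ) ⟨hr, by simpa using hθ⟩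

lemma hasDerivAt_weight_space {d : ℕ} {u : ℝ} (hu : 0 < u) (x θ : Vec d) (i : Fin d) (r : ℝ) :
    HasDerivAt (fun r : ℝ => weight u (x + r • EuclideanSpace.single i 1) θ)
      (weight u (x + r • EuclideanSpace.single i 1) θ *
        (-(x i + r - rexp (-u) * θ i) / (1 - rexp (-2 * u)))) r := by
  have hS := (one_sub_exp_pos hu).ne'
  have hline : HasDerivAt
      (fun r : ℝ => x + r • EuclideanSpace.single i (1 : ℝ) - rexp (-u) • θ)
      (EuclideanSpace.single i (1 : ℝ)) r := by
    simpa using (((hasDerivAt_id r).smul_const (EuclideanSpace.single i (1 : ℝ))).const_add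
      x).sub_const (rexp (-u) • θ)
  have hinner : ⟪x + r • EuclideanSpace.single i (1 : ℝ) - rexp (-u) • θ,
      EuclideanSpace.single i (1 : ℝ)⟫ = x i + r - rexp (-u) * θ i := by
    rw [EuclideanSpace.inner_single_right]
    simp
  refine ((hline.norm_sq.neg.div_const (2 * (1 - rexp (-2 * u)))).exp).congr_deriv ?_
  rw [hinner, weight]
  congr 1
  field_simp

/-- The derivative in `t` of the exponent of `weight t x θ`. -/
def logWeightDeriv {d : ℕ} (t : ℝ) (x θ : Vec d) : ℝ :=
  rexp (-t) ^ 2 / (1 - rexp (-2 * t)) ^ 2 * ‖x‖ ^ 2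
    - rexp (-t) * (2 - (1 - rexp (-2 * t))) / (1 - rexp (-2 * t)) ^ 2 * ⟪x, θ⟫
    + rexp (-t) ^ 2 / (1 - rexp (-2 * t)) ^ 2 * ‖θ‖ ^ 2

lemma exp_neg_two_mul (t : ℝ) : rexp (-2 * t) = rexp (-t) ^ 2 := by
  rw [← Real.exp_nat_mul]; ring_nf

lemma hasDerivAt_exp_neg (t : ℝ) : HasDerivAt (fun u : ℝ => rexp (-u)) (-rexp (-t)) t := by
  simpa using (hasDerivAt_neg t).exp

lemma hasDerivAt_one_sub_exp (t : ℝ) :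
    HasDerivAt (fun u : ℝ => 1 - rexp (-2 * u)) (2 * rexp (-t) ^ 2) t := by
  refine ((((hasDerivAt_id t).const_mul (-2)).exp).const_sub 1).congr_deriv ?_
  rw [← exp_neg_two_mul]
  simp
  ring

lemma hasDerivAt_weight_time {d : ℕ} {t : ℝ} (ht : 0 < t) (x θ : Vec d) :
    HasDerivAt (fun u => weight u x θ) (weight t x θ * logWeightDeriv t x θ) t := by
  have hS := (one_sub_exp_pos ht).ne'
  have hexp := hasDerivAt_exp_neg t
  have hnorm : ∀ u : ℝ, ‖x - rexp (-u) • θ‖ ^ 2 =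
      ‖x‖ ^ 2 - 2 * (rexp (-u) * ⟪x, θ⟫) + rexp (-u) ^ 2 * ‖θ‖ ^ 2 := by
    intro u
    rw [norm_sub_sq_real, inner_smul_right, norm_smul, mul_pow, Real.norm_eq_abs, sq_abs]
  unfold weight
  simp only [hnorm]
  refine ((((((hexp.mul_const ⟪x, θ⟫).const_mul 2).const_sub (‖x‖ ^ 2)).add
    ((hexp.pow 2).mul_const (‖θ‖ ^ 2))).neg.div ((hasDerivAt_one_sub_exp t).const_mul 2)
    (mul_ne_zero two_ne_zero hS)).exp).congr_deriv ?_
  congr 1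
  have hS' : 1 - rexp (-t) ^ 2 ≠ 0 := by rwa [← exp_neg_two_mul]
  simp only [logWeightDeriv, exp_neg_two_mul, Pi.add_apply, Pi.neg_apply, Pi.pow_apply]
  field_simp
  ring

lemma integral_weight_pos {d : ℕ} {q0 : Measure (Vec d)} [IsProbabilityMeasure q0] {u : ℝ}
    (hu : 0 < u) (x : Vec d) : 0 < ∫ θ, weight u x θ ∂q0 := by
  rw [integral_pos_iff_support_of_nonneg (fun θ => (weight_pos u x θ).le)
    (integrable_weight hu x)]
  have : Function.support (weight u x) = Set.univ :=
    Set.eq_univ_of_forall fun θ => (weight_pos u x θ).ne'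
  simp [this]

lemma lintegral_weight {d : ℕ} {q0 : Measure (Vec d)} [IsProbabilityMeasure q0] {u : ℝ}
    (hu : 0 < u) (x : Vec d) :
    ∫⁻ θ, ENNReal.ofReal (weight u x θ) ∂q0 = ENNReal.ofReal (∫ θ, weight u x θ ∂q0) :=
  (ofReal_integral_eq_lintegral_ofReal (integrable_weight hu x)
    (ae_of_all _ fun θ => (weight_pos u x θ).le)).symm

lemma isProbabilityMeasure_condMeasure {d : ℕ} (q0 : Measure (Vec d)) [IsProbabilityMeasure q0]
    {u : ℝ} (hu : 0 < u) (x : Vec d) : IsProbabilityMeasure (condMeasure q0 u x) := by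
  constructor
  rw [condMeasure, Measure.smul_apply, withDensity_apply _ MeasurableSet.univ,
    Measure.restrict_univ, smul_eq_mul, lintegral_weight hu]
  exact ENNReal.inv_mul_cancel (ENNReal.ofReal_pos.2 (integral_weight_pos hu x)).ne'
    ENNReal.ofReal_ne_top

lemma condMeasure_ae_norm_le {d : ℕ} {q0 : Measure (Vec d)} {R : ℝ} (hR : ∀ᵐ y ∂q0, ‖y‖ ≤ R)
    (u : ℝ) (x : Vec d) : ∀ᵐ y ∂(condMeasure q0 u x), ‖y‖ ≤ R :=
  ((withDensity_absolutelyContinuous q0 _).smul_left _).ae_le hR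

lemma integral_condMeasure {d : ℕ} (q0 : Measure (Vec d)) [IsProbabilityMeasure q0] {u : ℝ}
    (hu : 0 < u) (x : Vec d) (f : Vec d → ℝ) :
    ∫ θ, f θ ∂(condMeasure q0 u x) =
      (∫ θ, weight u x θ * f θ ∂q0) / ∫ θ, weight u x θ ∂q0 := by
  have hw : Measurable fun θ => ENNReal.ofReal (weight u x θ) :=
    (continuous_weight_right u x).measurable.ennreal_ofReal
  rw [condMeasure, integral_smul_measure, lintegral_weight hu,
    integral_withDensity_eq_integral_toReal_smul hw (ae_of_all _ fun _ => ENNReal.ofReal_lt_top),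
    ENNReal.toReal_inv, ENNReal.toReal_ofReal (integral_weight_pos hu x).le, smul_eq_mul,
    div_eq_inv_mul]
  simp only [ENNReal.toReal_ofReal (weight_pos u x _).le, smul_eq_mul]

lemma condMean_apply {d : ℕ} {q0 : Measure (Vec d)} [IsProbabilityMeasure q0] {R : ℝ}
    (hR : ∀ᵐ y ∂q0, ‖y‖ ≤ R) {u : ℝ} (hu : 0 < u) (x : Vec d) (i : Fin d) :
    condMean q0 u x i = ∫ θ, θ i ∂(condMeasure q0 u x) := by
  have := isProbabilityMeasure_condMeasure q0 hu x
  have hint : Integrable (fun θ : Vec d => θ) (condMeasure q0 u x) :=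
    Integrable.of_bound aestronglyMeasurable_id R (condMeasure_ae_norm_le hR u x)
  exact ((EuclideanSpace.proj (𝕜 := ℝ) i).integral_comp_comm hint).symm

lemma pd_log_density {d : ℕ} {q0 : Measure (Vec d)} [IsProbabilityMeasure q0] {R : ℝ}
    (hR : ∀ᵐ y ∂q0, ‖y‖ ≤ R) {u : ℝ} (hu : 0 < u) {f : Vec d → ℝ}
    (hf : forwardLaw q0 u = volume.withDensity fun x => ENNReal.ofReal (f x))
    (hf_pos : ∀ x, 0 < f x) (hf_diff : Differentiable ℝ f) (x : Vec d) (i : Fin d) :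
    pd i (fun y => Real.log (f y)) x =
      (rexp (-u) * condMean q0 u x i - x i) / (1 - rexp (-2 * u)) := by
  have hS := (one_sub_exp_pos hu).ne'
  have hZ := (integral_weight_pos (q0 := q0) hu x).ne'
  have hc := (gaussianConst_pos d hu).ne'
  have hfx := density_eq q0 hu hf hf_diff.continuous fun y => (hf_pos y).le
  have hZ_deriv := hasDerivAt_integral_of_ae_norm_le hR (r₀ := 0)
    (F := fun r θ => weight u (x + r • EuclideanSpace.single i 1) θ)
    (Icc_mem_nhds neg_one_lt_zero one_pos) isCompact_Icc
    (fun r _ => continuous_weight_right u _) (by unfold weight; fun_prop)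
    fun r _ θ => hasDerivAt_weight_space hu x θ i r
  have hlog := ((hZ_deriv.const_mul (gaussianConst d u)).log (by simpa using ⟨hc, hZ⟩))
  simp only [← hfx] at hlog
  rw [pd, ← ((hf_diff x).log (hf_pos x).ne').lineDeriv_eq_fderiv, lineDeriv, hlog.deriv,
    hfx,
    condMean_apply hR hu, integral_condMeasure q0 hu]
  simp only [zero_smul, add_zero]
  have hi : Integrable (fun θ => weight u x θ * θ i) q0 :=
    integrable_of_continuous_of_ae_norm_le hR
      ((continuous_weight_right u x).mul (by fun_prop))
  have hnum : ∫ θ, weight u x θ * (-(x i - rexp (-u) * θ i) / (1 - rexp (-2 * u))) ∂q0 =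
      (rexp (-u) * ∫ θ, weight u x θ * θ i ∂q0 - x i * ∫ θ, weight u x θ ∂q0) /
        (1 - rexp (-2 * u)) := by
    rw [← integral_const_mul, ← integral_const_mul, ← integral_sub (hi.const_mul _)
      ((integrable_weight hu x).const_mul _), ← integral_div]
    congr 1 with θ
    ring
  rw [hnum]
  generalize 1 - rexp (-2 * u) = S at hS
  field_simp

lemma continuousOn_weight_mul_logWeightDeriv {d : ℕ} (x : Vec d) {f : Vec d → ℝ}
    (hf : Continuous f) {s : Set ℝ} (hs : ∀ u ∈ s, 0 < u) :
    ContinuousOn (Function.uncurry fun u θ => weight u x θ * logWeightDeriv u x θ * f θ)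
      (s ×ˢ Set.univ) := by
  have hS : ∀ p ∈ s ×ˢ (Set.univ : Set (Vec d)), 1 - rexp (-2 * p.1) ≠ 0 :=
    fun p hp => (one_sub_exp_pos (hs p.1 hp.1)).ne'
  have hS' : ∀ p ∈ s ×ˢ (Set.univ : Set (Vec d)), (1 - rexp (-2 * p.1)) ^ 2 ≠ 0 :=
    fun p hp => pow_ne_zero 2 (hS p hp)
  have hS'' : ∀ p ∈ s ×ˢ (Set.univ : Set (Vec d)), 2 * (1 - rexp (-2 * p.1)) ≠ 0 :=
    fun p hp => mul_ne_zero two_ne_zero (hS p hp)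
  unfold weight logWeightDeriv Function.uncurry
  fun_prop (disch := assumption)

lemma hasDerivAt_integral_weight_mul {d : ℕ} {q0 : Measure (Vec d)} [IsFiniteMeasure q0] {R : ℝ}
    (hR : ∀ᵐ y ∂q0, ‖y‖ ≤ R) {t : ℝ} (ht : 0 < t) (x : Vec d) {f : Vec d → ℝ}
    (hf : Continuous f) :
    HasDerivAt (fun u => ∫ θ, weight u x θ * f θ ∂q0)
      (∫ θ, weight t x θ * logWeightDeriv t x θ * f θ ∂q0) t := by
  have hpos : ∀ u ∈ Set.Icc (t / 2) (2 * t), 0 < u := fun u hu => by linarith [hu.1]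
  refine hasDerivAt_integral_of_ae_norm_le hR
    (Icc_mem_nhds (by linarith : t / 2 < t) (by linarith : t < 2 * t)) isCompact_Icc
    (fun u _ => (continuous_weight_right u x).mul hf)
    (continuousOn_weight_mul_logWeightDeriv x hf hpos)
    fun u hu θ => (hasDerivAt_weight_time (hpos u hu) x θ).mul_const _

lemma continuous_logWeightDeriv {d : ℕ} (t : ℝ) (x : Vec d) :
    Continuous (logWeightDeriv t x) := by
  unfold logWeightDeriv
  fun_prop

/-- The time derivative of a conditional expectation is a conditional covariance. -/
lemma hasDerivAt_integral_condMeasure {d : ℕ} {q0 : Measure (Vec d)} [IsProbabilityMeasure q0]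
    {R : ℝ} (hR : ∀ᵐ y ∂q0, ‖y‖ ≤ R) {t : ℝ} (ht : 0 < t) (x : Vec d) {f : Vec d → ℝ}
    (hf : Continuous f) :
    HasDerivAt (fun u => ∫ θ, f θ ∂(condMeasure q0 u x))
      (∫ θ, (f θ - ∫ η, f η ∂(condMeasure q0 t x)) * logWeightDeriv t x θ
        ∂(condMeasure q0 t x)) t := by
  have := isProbabilityMeasure_condMeasure q0 ht x
  have hZ := (integral_weight_pos (q0 := q0) ht x).ne'
  have hL := continuous_logWeightDeriv t x
  have hint : ∀ {h : Vec d → ℝ}, Continuous h → Integrable h (condMeasure q0 t x) :=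
    integrable_of_continuous_of_ae_norm_le (condMeasure_ae_norm_le hR t x)
  have hden := hasDerivAt_integral_weight_mul hR ht x (continuous_const (y := (1 : ℝ)))
  simp only [mul_one] at hden
  refine (((hasDerivAt_integral_weight_mul hR ht x hf).div hden hZ).congr_of_eventuallyEq
    ?_).congr_deriv ?_
  · filter_upwards [eventually_gt_nhds ht] with u hu
    exact integral_condMeasure q0 hu x f
  · simp only [sub_mul]
    rw [integral_sub (hint (by fun_prop)) (hint (by fun_prop)), integral_const_mul,
      integral_condMeasure q0 ht, integral_condMeasure q0 ht, integral_condMeasure q0 ht]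
    have hcomm : ∫ θ, weight t x θ * (f θ * logWeightDeriv t x θ) ∂q0 =
        ∫ θ, weight t x θ * logWeightDeriv t x θ * f θ ∂q0 := by
      congr 1 with θ
      ring
    rw [hcomm]
    field_simp

lemma integral_sub_condMean_mul_logWeightDeriv {d : ℕ} {q0 : Measure (Vec d)}
    [IsProbabilityMeasure q0] {R : ℝ} (hR : ∀ᵐ y ∂q0, ‖y‖ ≤ R) {t : ℝ} (ht : 0 < t)
    (x : Vec d) (i : Fin d) :
    ∫ θ, (θ i - condMean q0 t x i) * logWeightDeriv t x θ ∂(condMeasure q0 t x) =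
      -(rexp (-t) * (2 - (1 - rexp (-2 * t))) / (1 - rexp (-2 * t)) ^ 2) *
        ∑ j, (∫ θ, (θ i - condMean q0 t x i) * (θ j - condMean q0 t x j)
          ∂(condMeasure q0 t x)) * x j
      + rexp (-t) ^ 2 / (1 - rexp (-2 * t)) ^ 2 *
        ∫ θ, ‖θ‖ ^ 2 * (θ i - condMean q0 t x i) ∂(condMeasure q0 t x) := by
  have := isProbabilityMeasure_condMeasure q0 ht x
  set m := condMean q0 t x
  have hint : ∀ {h : Vec d → ℝ}, Continuous h → Integrable h (condMeasure q0 t x) :=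
    integrable_of_continuous_of_ae_norm_le (condMeasure_ae_norm_le hR t x)
  have hcentred : ∫ θ, (θ i - m i) ∂(condMeasure q0 t x) = 0 := by
    rw [integral_sub (hint (by fun_prop)) (integrable_const _), ← condMean_apply hR ht]
    simp [m]
  set b := rexp (-t) * (2 - (1 - rexp (-2 * t))) / (1 - rexp (-2 * t)) ^ 2
  set c := rexp (-t) ^ 2 / (1 - rexp (-2 * t)) ^ 2
  have hsum : ∑ j, (∫ θ, (θ i - m i) * (θ j - m j) ∂(condMeasure q0 t x)) * x j =
      ∫ θ, (θ i - m i) * (⟪x, θ⟫ - ⟪x, m⟫) ∂(condMeasure q0 t x) := by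
    simp only [← integral_mul_const]
    rw [← integral_finsetSum _ fun j _ => hint (by fun_prop)]
    congr 1 with θ
    rw [← inner_sub_right, PiLp.inner_apply, Finset.mul_sum]
    refine Finset.sum_congr rfl fun j _ => ?_
    simp
    ring
  have hexpand : ∀ θ : Vec d, (θ i - m i) * logWeightDeriv t x θ =
      (c * ‖x‖ ^ 2 - b * ⟪x, m⟫) * (θ i - m i) + -b * ((θ i - m i) * (⟪x, θ⟫ - ⟪x, m⟫))
        + c * (‖θ‖ ^ 2 * (θ i - m i)) := by
    intro θ
    simp only [logWeightDeriv, b, c]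
    ring
  simp only [hexpand]
  rw [integral_add (hint (by fun_prop)) (hint (by fun_prop)),
    integral_add (hint (by fun_prop)) (hint (by fun_prop)), integral_const_mul,
    integral_const_mul, integral_const_mul, hcentred, hsum]
  ring

/-- **Lemma (time derivative of the score).** Under the bounded-support assumption, for `t > 0`
and `x ∈ ℝ^d`,
`∂_t ∇_x log q_t(x) = -(λ_t(2-σ_t²)/σ_t⁴) m(t,x) + (2λ_t²/σ_t⁴) x - (λ_t²(2-σ_t²)/σ_t⁶) C_t(x) x
  + (λ_t³/σ_t⁶) v_t(x)`, stated coordinatewise. -/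
theorem partial_t_score
    {d : ℕ} (hd : 1 ≤ d) (q0 : Measure (Vec d)) [IsProbabilityMeasure q0]
    (ρ : ℝ → Vec d → ℝ)
    (hρ : ∀ u, 0 < u → forwardLaw q0 u = volume.withDensity fun x => ENNReal.ofReal (ρ u x))
    (hρpos : ∀ u, 0 < u → ∀ x, 0 < ρ u x)
    (hρsmooth : ∀ u, 0 < u → ContDiff ℝ (⊤ : ℕ∞) (ρ u))
    (hsupp : ∀ᵐ y ∂q0, ‖y‖ ≤ Real.sqrt d)
    (t : ℝ) (ht : 0 < t) (x : Vec d) (i : Fin d) :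
    HasDerivAt (fun u => pd i (fun y => Real.log (ρ u y)) x)
      (-(Real.exp (-t) * (2 - (1 - Real.exp (-2*t))) / (1 - Real.exp (-2*t))^2)
          * condMean q0 t x i
        + (2 * Real.exp (-t)^2 / (1 - Real.exp (-2*t))^2) * x i
        - (Real.exp (-t)^2 * (2 - (1 - Real.exp (-2*t))) / (1 - Real.exp (-2*t))^3)
          * ∑ j, (∫ θ, (θ i - condMean q0 t x i) * (θ j - condMean q0 t x j)
                    ∂(condMeasure q0 t x)) * x j
        + (Real.exp (-t)^3 / (1 - Real.exp (-2*t))^3)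
          * ∫ θ, ‖θ‖^2 * (θ i - condMean q0 t x i) ∂(condMeasure q0 t x)) t := by
  have hS := (one_sub_exp_pos ht).ne'
  have hmean : HasDerivAt (fun u => condMean q0 u x i)
      (∫ θ, (θ i - condMean q0 t x i) * logWeightDeriv t x θ ∂(condMeasure q0 t x)) t := by
    rw [condMean_apply hsupp ht]
    refine (hasDerivAt_integral_condMeasure hsupp ht x (by fun_prop)).congr_of_eventuallyEq ?_
    filter_upwards [eventually_gt_nhds ht] with u hu using condMean_apply hsupp hu x i
  rw [integral_sub_condMean_mul_logWeightDeriv hsupp ht] at hmean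
  refine (((((hasDerivAt_exp_neg t).mul hmean).sub_const (x i)).div
    (hasDerivAt_one_sub_exp t) hS).congr_of_eventuallyEq ?_).congr_deriv ?_
  · filter_upwards [eventually_gt_nhds ht] with u hu
    exact pd_log_density hsupp hu (hρ u hu) (hρpos u hu)
      ((hρsmooth u hu).differentiable (by simp)) x i
  · have hsq : rexp (-t) ^ 2 = 1 - (1 - rexp (-2 * t)) := by
      rw [← exp_neg_two_mul]; ring
    simp only [Pi.mul_apply]
    generalize 1 - rexp (-2 * t) = S at hS hsq
    generalize rexp (-t) = l at hsq
    field_simp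
    linear_combination (-2 * l * condMean q0 t x i * S) * hsq

end
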